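/- arXiv:1509.01679 — 2 statements merged into one kernel-verified Lean document; each statement's English description precedes it below -/
import Mathlib

section
/- Let f : ℝⁿ → ℝ be Lipschitz continuous and let μ > 0. Define f^μ(x) = E[f(x + μ·ẽ)], where ẽ is uniformly distributed on the closed unit Euclidean ball of ℝⁿ. Then f^μ is differentiable at every x ∈ ℝⁿ and its gradient satisfies ∇f^μ(x) = (n/μ)·E[f(x + μ·e)·e], where e is a random vector uniformly distributed on the unit Euclidean sphere of ℝⁿ. -/
open MeasureTheory Metric

/-- The uniform probability distribution (normalized Lebesgue measure) on the closed unit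
Euclidean ball of `ℝⁿ`. -/
noncomputable def uniformBall (n : ℕ) : Measure (EuclideanSpace ℝ (Fin n)) :=
  (volume (Metric.closedBall (0 : EuclideanSpace ℝ (Fin n)) 1))⁻¹ •
    volume.restrict (Metric.closedBall (0 : EuclideanSpace ℝ (Fin n)) 1)

/-- A probability measure on `ℝⁿ` which is carried by the unit Euclidean sphere and is
invariant under all linear isometries: the (unique) uniform distribution on the sphere. -/
def IsUniformOnSphere {n : ℕ} (σ : Measure (EuclideanSpace ℝ (Fin n))) : Prop :=
  IsProbabilityMeasure σ ∧
    σ (Metric.sphere (0 : EuclideanSpace ℝ (Fin n)) 1)ᶜ = 0 ∧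
    ∀ T : EuclideanSpace ℝ (Fin n) ≃ₗᵢ[ℝ] EuclideanSpace ℝ (Fin n), σ.map T = σ


section aux
set_option linter.unusedSectionVars false
variable {E : Type*} [NormedAddCommGroup E] [InnerProductSpace ℝ E] [FiniteDimensional ℝ E]
  [MeasurableSpace E] [BorelSpace E]

lemma charFun_radial (σ : Measure E) (h : ∀ T : E ≃ₗᵢ[ℝ] E, σ.map T = σ) {v w : E}
    (hvw : ‖v‖ = ‖w‖) : charFun σ v = charFun σ w := by
  set T : E ≃ₗᵢ[ℝ] E := (Submodule.span ℝ {v - w})ᗮ.reflection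
  have hT : T v = w := Submodule.reflection_sub hvw
  rw [charFun_apply, charFun_apply]
  conv_rhs => rw [← h T]
  rw [integral_map T.continuous.aemeasurable (by fun_prop), ← hT]
  simp only [LinearIsometryEquiv.inner_map_map]

lemma sphere_unique (σ ν : Measure E) [IsProbabilityMeasure σ] [IsFiniteMeasure ν]
    (hs : ∀ᵐ x ∂σ, ‖x‖ = 1) (hn : ∀ᵐ x ∂ν, ‖x‖ = 1)
    (h : ∀ T : E ≃ₗᵢ[ℝ] E, σ.map T = σ) (h' : ∀ T : E ≃ₗᵢ[ℝ] E, ν.map T = ν) :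
    ν = ν Set.univ • σ := by
  have : IsFiniteMeasure (ν Set.univ • σ) := Measure.smul_finite _ (measure_ne_top _ _)
  apply Measure.ext_of_charFun
  funext t
  have e1 : ∫ x, ∫ y, Complex.exp (((‖t‖ * inner ℝ y x : ℝ) : ℂ) * Complex.I) ∂ν ∂σ
      = charFun ν t := by
    have : ∀ᵐ x ∂σ, ∫ y, Complex.exp (((‖t‖ * inner ℝ y x : ℝ) : ℂ) * Complex.I) ∂ν
        = charFun ν t := by
      filter_upwards [hs] with x hx
      rw [charFun_radial ν h' (v := t) (w := ‖t‖ • x) (by simp [norm_smul, hx]), charFun_apply]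
      simp only [inner_smul_right]
    rw [integral_congr_ae this]
    simp
  have e2 : ∫ y, ∫ x, Complex.exp (((‖t‖ * inner ℝ y x : ℝ) : ℂ) * Complex.I) ∂σ ∂ν
      = charFun (ν Set.univ • σ) t := by
    have : ∀ᵐ y ∂ν, ∫ x, Complex.exp (((‖t‖ * inner ℝ y x : ℝ) : ℂ) * Complex.I) ∂σ
        = charFun σ t := by
      filter_upwards [hn] with x hx
      rw [charFun_radial σ h (v := t) (w := ‖t‖ • x) (by simp [norm_smul, hx]), charFun_apply]
      simp only [inner_smul_right, real_inner_comm]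
    rw [integral_congr_ae this, charFun_apply (μ := ν Set.univ • σ), integral_smul_measure,
      ← charFun_apply]
    simp [Measure.real]
  rw [← e1, ← e2]
  apply integral_integral_swap
  refine Integrable.of_bound (C := 1) ?_ ?_
  · apply Continuous.aestronglyMeasurable
    unfold Function.uncurry
    fun_prop
  · filter_upwards with p
    simp only [Function.uncurry]
    rw [Complex.norm_exp_ofReal_mul_I]

open scoped Pointwise in
lemma toSphere_inv (T : E ≃ₗᵢ[ℝ] E) :
    ((volume : Measure E).toSphere.map Subtype.val).map T =
      (volume : Measure E).toSphere.map Subtype.val := by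
  ext A hA
  have hm := T.continuous.measurable
  rw [Measure.map_apply hm hA, Measure.map_apply measurable_subtype_coe (hm hA),
    Measure.map_apply measurable_subtype_coe hA,
    Measure.toSphere_apply' _ (measurable_subtype_coe (hm hA)),
    Measure.toSphere_apply' _ (measurable_subtype_coe hA),
    ← T.measurePreserving.measure_preimage_emb T.toHomeomorph.measurableEmbedding
      (Set.Ioo (0:ℝ) 1 • (Set.image Subtype.val (Set.preimage Subtype.val A : Set (sphere (0:E) 1))))]
  congr 2
  ext z
  simp only [Set.mem_smul, Set.mem_preimage, Set.mem_image, Subtype.exists]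
  constructor
  · rintro ⟨r, hr, y, ⟨w, hw, hwA, rfl⟩, rfl⟩
    exact ⟨r, hr, T w, ⟨T w, by simpa using hw, hwA, rfl⟩, by simp⟩
  · rintro ⟨r, hr, y, ⟨w, hw, hwA, rfl⟩, hz⟩
    refine ⟨r, hr, T.symm w, ⟨T.symm w, by simpa using hw, by simpa using hwA, rfl⟩, ?_⟩
    apply T.injective
    simp [hz]

lemma polar [Nontrivial E] (φ : E → ℝ) (hφ : Integrable φ) :
    Integrable (fun θ : sphere (0:E) 1 => ∫ r in Set.Ioi (0:ℝ),
      r ^ (Module.finrank ℝ E - 1) * φ (r • (θ:E))) (volume : Measure E).toSphere ∧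
    ∫ z, φ z = ∫ θ, (∫ r in Set.Ioi (0:ℝ),
      r ^ (Module.finrank ℝ E - 1) * φ (r • (θ:E))) ∂(volume : Measure E).toSphere := by
  set d := Module.finrank ℝ E - 1 with hd
  have mp := (volume : Measure E).measurePreserving_homeomorphUnitSphereProd
  have emb := (homeomorphUnitSphereProd E).measurableEmbedding
  let ψ : sphere (0:E) 1 × Set.Ioi (0:ℝ) → ℝ := fun p => φ ((p.2:ℝ) • (p.1:E))
  have hψ : ∀ x, ψ (homeomorphUnitSphereProd E x) = φ x := by
    intro x
    simp only [ψ]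
    rw [← homeomorphUnitSphereProd_symm_apply_coe]
    simp
  have hint : Integrable ψ
      ((volume : Measure E).toSphere.prod (Measure.volumeIoiPow d)) := by
    rw [← mp.integrable_comp_emb emb]
    have : ψ ∘ homeomorphUnitSphereProd E = φ ∘ Subtype.val := funext hψ
    rw [this, ← integrableOn_iff_comap_subtypeVal (measurableSet_singleton _).compl]
    exact hφ.integrableOn
  have hin : ∀ θ : sphere (0:E) 1, ∫ r, ψ (θ, r) ∂(Measure.volumeIoiPow d) =
      ∫ r in Set.Ioi (0:ℝ), r ^ d * φ (r • (θ:E)) := by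
    intro θ
    simp only [Measure.volumeIoiPow, ENNReal.ofReal]
    rw [integral_withDensity_eq_integral_smul,
        integral_subtype_comap measurableSet_Ioi
          fun a : ℝ ↦ Real.toNNReal (a ^ d) • φ (a • (θ:E)),
        setIntegral_congr_fun measurableSet_Ioi fun x hx ↦ ?_]
    · rw [NNReal.smul_def, Real.coe_toNNReal _ (pow_nonneg hx.out.le _), smul_eq_mul]
    · exact (measurable_subtype_coe.pow_const _).real_toNNReal
  simp only [← hin]
  refine ⟨hint.integral_prod_left, ?_⟩
  rw [← integral_prod _ hint, ← mp.integral_comp emb]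
  simp only [hψ]
  rw [integral_subtype_comap (measurableSet_singleton _).compl, restrict_compl_singleton]

/-- The radial extent of the ball `closedBall h 1` in direction `θ`. -/
noncomputable def rho (h θ : E) : ℝ :=
  inner ℝ θ h + Real.sqrt (1 - ‖h‖ ^ 2 + (inner ℝ θ h) ^ 2)

lemma rho_iff {h θ : E} (hh : ‖h‖ < 1) (hθ : ‖θ‖ = 1) {r : ℝ} (hr : 0 < r) :
    ‖r • θ - h‖ ≤ 1 ↔ r ≤ rho h θ := by
  have h0 := norm_nonneg h
  have key : ‖r • θ - h‖ ^ 2 = r ^ 2 - 2 * r * inner ℝ θ h + ‖h‖ ^ 2 := by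
    rw [norm_sub_sq_real, norm_smul, hθ, inner_smul_left]
    simp; ring
  have hpos : 0 < 1 - ‖h‖ ^ 2 := by nlinarith
  rw [rho]
  set a := inner ℝ θ h
  set s := Real.sqrt (1 - ‖h‖ ^ 2 + a ^ 2) with hs
  have hs0 : 0 ≤ s := Real.sqrt_nonneg _
  have hs2 : s ^ 2 = 1 - ‖h‖ ^ 2 + a ^ 2 := Real.sq_sqrt (by positivity)
  have hsa : |a| < s := by
    rw [← abs_of_nonneg hs0]; exact sq_lt_sq.1 (by linarith)
  have e1 : ‖r • θ - h‖ ≤ 1 ↔ (r - a) ^ 2 ≤ s ^ 2 := by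
    rw [← sq_le_one_iff₀ (norm_nonneg _), key, hs2]
    constructor <;> intro h <;> linarith
  rw [e1, sq_le_sq, abs_of_nonneg hs0, abs_le]
  have := (abs_lt.1 hsa).2
  constructor
  · intro h; linarith [h.2]
  · intro h; constructor <;> linarith

lemma rho_bound {h θ : E} (hh : ‖h‖ < 1) (hθ : ‖θ‖ = 1) : |rho h θ - 1| ≤ ‖h‖ := by
  have h0 := norm_nonneg h
  have hpos : 0 < 1 - ‖h‖ ^ 2 := by nlinarith
  have ha : |inner ℝ θ h| ≤ ‖h‖ := by
    simpa [hθ] using abs_real_inner_le_norm θ h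
  rw [rho]
  set a := inner ℝ θ h
  obtain ⟨ha1, ha2⟩ := abs_le.1 ha
  rw [abs_le]
  constructor
  · have : 1 - ‖h‖ - a ≤ Real.sqrt (1 - ‖h‖ ^ 2 + a ^ 2) := by
      apply Real.le_sqrt_of_sq_le; nlinarith
    linarith
  · have : Real.sqrt (1 - ‖h‖ ^ 2 + a ^ 2) ≤ 1 + ‖h‖ - a := by
      apply Real.sqrt_le_iff.2; constructor <;> nlinarith
    linarith

lemma rho_zero (θ : E) : rho 0 θ = 1 := by simp [rho]

lemma rho_deriv (θ : E) : HasFDerivAt (fun h => rho h θ) (innerSL ℝ θ) 0 := by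
  have h1 : HasFDerivAt (fun h : E => inner ℝ θ h) (innerSL ℝ θ) 0 :=
    (innerSL ℝ θ).hasFDerivAt
  have h2 : HasFDerivAt (fun h : E => ‖h‖ ^ 2) (2 • (innerSL ℝ (0:E))) 0 :=
    (hasStrictFDerivAt_norm_sq (0:E)).hasFDerivAt
  have h3 := (((h2.const_sub 1).add (h1.pow 2)).sqrt (by simp))
  have h4 := h1.add h3
  refine h4.congr_fderiv ?_
  ext v
  simp

lemma ball_deriv [Nontrivial E] (g : E → ℝ) (hg : Continuous g) :
    Integrable (fun θ : sphere (0:E) 1 => g θ • innerSL ℝ (θ:E)) (volume : Measure E).toSphere ∧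
    HasFDerivAt (fun h : E => ∫ e in closedBall (0:E) 1, g (e + h))
      (∫ θ, g θ • innerSL ℝ (θ:E) ∂(volume : Measure E).toSphere) 0 := by
  set d := Module.finrank ℝ E - 1 with hd
  let F : E → sphere (0:E) 1 → ℝ := fun h θ => ∫ r in (0:ℝ)..(rho h θ), r ^ d * g (r • (θ:E))
  have hcont : ∀ θ : E, Continuous (fun r : ℝ => r ^ d * g (r • θ)) := by intro θ; fun_prop
  have hs : ball (0:E) (1/2) ∈ nhds (0:E) := ball_mem_nhds _ (by norm_num)
  have hF : ∀ h ∈ ball (0:E) (1/2), Integrable (F h) (volume : Measure E).toSphere ∧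
      ∫ e in closedBall (0:E) 1, g (e + h) = ∫ θ, F h θ ∂(volume : Measure E).toSphere := by
    intro h hh
    have hh1 : ‖h‖ < 1 := by
      have : ‖h‖ < 1/2 := by simpa using hh
      linarith
    have hgi : Integrable ((closedBall h 1).indicator g) := by
      rw [integrable_indicator_iff measurableSet_closedBall]
      exact hg.continuousOn.integrableOn_compact (isCompact_closedBall _ _)
    have := polar _ hgi
    have hE : ∀ θ : sphere (0:E) 1, (∫ r in Set.Ioi (0:ℝ),
      r ^ d * (closedBall h 1).indicator g (r • (θ:E))) = F h θ := by
      intro θ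
      have hθ : ‖(θ:E)‖ = 1 := by simpa using θ.2
      have hr0 : 0 ≤ rho h θ := by
        have := (abs_le.1 (rho_bound hh1 hθ)).1
        linarith
      simp only [F]
      rw [intervalIntegral.integral_of_le hr0, ← integral_indicator measurableSet_Ioi,
        ← integral_indicator measurableSet_Ioc]
      congr 1
      funext r
      by_cases hr : 0 < r
      · have := rho_iff hh1 hθ hr
        by_cases h2 : r ≤ rho h θ
        · have h3 := this.2 h2
          simp [Set.indicator, hr, h2, dist_eq_norm, h3]
        · have h3 := mt this.1 h2
          simp [Set.indicator, h2, dist_eq_norm, h3]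
      · simp [Set.indicator, hr]
    rw [← hd] at this
    simp only [hE] at this
    refine ⟨this.1, ?_⟩
    rw [← this.2, ← integral_indicator measurableSet_closedBall,
      ← integral_add_right_eq_self ((closedBall h 1).indicator g) h]
    congr 1
    funext e
    simp [Set.indicator, dist_eq_norm]
  obtain ⟨M, hM⟩ := (isCompact_closedBall (0:E) 2).exists_bound_of_continuousOn hg.continuousOn
  have hM0 : 0 ≤ M := (norm_nonneg _).trans (hM 0 (by simp))
  have main := hasFDerivAt_integral_of_dominated_loc_of_lip' (𝕜 := ℝ)
    (μ := (volume : Measure E).toSphere)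
    (F := F) (x₀ := 0) (bound := fun _ => 2 ^ d * M)
    (F' := fun θ : sphere (0:E) 1 => g θ • innerSL ℝ (θ:E)) hs
    (fun h hh => (hF h hh).1.aestronglyMeasurable)
    (hF 0 (by simp)).1
    (by
      apply Continuous.aestronglyMeasurable
      fun_prop)
    (by
      filter_upwards with θ h hh
      have hθ : ‖(θ:E)‖ = 1 := by simpa using θ.2
      have hh1 : ‖h‖ < 1/2 := by simpa using hh
      have hb := rho_bound (by linarith) hθ (h := h)
      simp only [F]
      rw [intervalIntegral.integral_interval_sub_left ((hcont θ).intervalIntegrable _ _)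
        ((hcont θ).intervalIntegrable _ _), rho_zero, sub_zero]
      refine (intervalIntegral.norm_integral_le_of_norm_le_const
        (C := 2 ^ d * M) ?_).trans ?_
      · intro r hr
        have hb2 := abs_le.1 hb
        rw [Set.mem_uIoc] at hr
        have hr2 : 0 ≤ r ∧ r ≤ 2 := by
          rcases hr with hr | hr <;> constructor <;> linarith [hr.1, hr.2, hb2.1, hb2.2]
        rw [norm_mul, norm_pow, Real.norm_of_nonneg hr2.1]
        have := hM (r • (θ:E)) (by simp [norm_smul, abs_of_nonneg hr2.1, hr2.2])
        gcongr
        · exact hr2.1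
        · exact hr2.2
      · gcongr)
    (integrable_const _)
    (by
      filter_upwards with θ
      have h1 : HasDerivAt (fun u => ∫ r in (0:ℝ)..u, r ^ d * g (r • (θ:E))) (g θ)
          (rho 0 (θ:E)) := by
        have := ((hcont θ).integral_hasStrictDerivAt 0 1).hasDerivAt
        rw [rho_zero]
        simpa using this
      exact h1.comp_hasFDerivAt (0:E) (rho_deriv (θ:E)))
  refine ⟨main.1, main.2.congr_of_eventuallyEq ?_⟩
  filter_upwards [hs] with h hh
  exact (hF h hh).2

end aux

/-- If `f : ℝⁿ → ℝ` is Lipschitz and `μ > 0`, then the smoothed function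
`f^μ(x) = E[f(x + μ ẽ)]` (with `ẽ` uniform on the closed unit ball) is differentiable
everywhere, with gradient `∇f^μ(x) = (n/μ) E[f(x + μ e) e]`, where `e` is uniform on the
unit Euclidean sphere. -/
theorem smoothed_gradient_formula {n : ℕ} (f : EuclideanSpace ℝ (Fin n) → ℝ)
    (K : NNReal) (hlip : LipschitzWith K f) (μ : ℝ) (hμ : 0 < μ)
    (σ : Measure (EuclideanSpace ℝ (Fin n))) (hσ : IsUniformOnSphere σ)
    (x : EuclideanSpace ℝ (Fin n)) :
    HasGradientAt (fun y => ∫ e, f (y + μ • e) ∂(uniformBall n))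
      ((n / μ) • ∫ e, f (x + μ • e) • e ∂σ) x := by
  obtain ⟨hp, hsupp, hinv⟩ := hσ
  have hs : ∀ᵐ z ∂σ, ‖z‖ = 1 := by
    have : ∀ᵐ z ∂σ, z ∈ sphere (0 : EuclideanSpace ℝ (Fin n)) 1 := mem_ae_iff.2 hsupp
    filter_upwards [this] with z hz
    simpa using hz
  have hnt : Nontrivial (EuclideanSpace ℝ (Fin n)) := by
    obtain ⟨z, hz⟩ := hs.exists
    exact ⟨⟨z, 0, fun h => by simp [h] at hz⟩⟩
  set τ := (volume : Measure (EuclideanSpace ℝ (Fin n))).toSphere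
  let g : (EuclideanSpace ℝ (Fin n)) → ℝ := fun e => f (x + μ • e)
  have hg : Continuous g := by
    have := hlip.continuous
    fun_prop
  set V : ℝ := (volume : Measure (EuclideanSpace ℝ (Fin n))).real (closedBall 0 1) with hV
  have hV0 : V ≠ 0 := by
    rw [hV, Measure.real]
    exact (ENNReal.toReal_pos (measure_closedBall_pos _ _ one_pos).ne'
      measure_closedBall_lt_top.ne).ne'
  have hτ : τ.map Subtype.val = (τ.map Subtype.val) Set.univ • σ := by
    refine sphere_unique σ _ hs ?_ hinv toSphere_inv
    rw [ae_map_iff measurable_subtype_coe.aemeasurable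
      (isClosed_eq continuous_norm continuous_const).measurableSet]
    filter_upwards with θ
    simp
  have hmass : ((τ.map Subtype.val) Set.univ).toReal = n * V := by
    rw [Measure.map_apply measurable_subtype_coe MeasurableSet.univ, Set.preimage_univ,
      Measure.toSphere_apply_univ, hV, Measure.real, Measure.addHaar_closedBall_eq_addHaar_ball]
    simp
  obtain ⟨hint, hder⟩ := ball_deriv g hg
  have hI : ∫ θ, g θ • innerSL ℝ (θ:(EuclideanSpace ℝ (Fin n))) ∂τ =
      InnerProductSpace.toDual ℝ (EuclideanSpace ℝ (Fin n)) ((n * V) • ∫ e, g e • e ∂σ) := by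
    rw [← hmass, ← integral_smul_measure, ← hτ,
      integral_map measurable_subtype_coe.aemeasurable (by fun_prop)]
    have hint2 : Integrable (fun θ : sphere (0:(EuclideanSpace ℝ (Fin n))) 1 => g θ • (θ:(EuclideanSpace ℝ (Fin n)))) τ := by
      refine Integrable.mono' hint.norm (by fun_prop) ?_
      filter_upwards with θ
      simp [norm_smul]
    have := (innerSL ℝ (E := EuclideanSpace ℝ (Fin n))).integral_comp_comm hint2
    simp only [map_smul] at this
    rw [this]
    rfl
  have hF : (fun y => ∫ e, f (y + μ • e) ∂(uniformBall n)) =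
      fun y => V⁻¹ • ∫ e in closedBall (0:(EuclideanSpace ℝ (Fin n))) 1, g (e + μ⁻¹ • (y - x)) := by
    funext y
    rw [uniformBall, integral_smul_measure, ENNReal.toReal_inv]
    congr 2
    funext e
    simp only [g]
    congr 1
    rw [smul_add, smul_inv_smul₀ hμ.ne']
    abel
  rw [hasGradientAt_iff_hasFDerivAt, hF]
  have hA : HasFDerivAt (fun y : (EuclideanSpace ℝ (Fin n)) => μ⁻¹ • (y - x)) (μ⁻¹ • ContinuousLinearMap.id ℝ (EuclideanSpace ℝ (Fin n))) x :=
    ((hasFDerivAt_id x).sub_const x).const_smul μ⁻¹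
  have h0 : μ⁻¹ • (x - x) = 0 := by simp
  have hder' : HasFDerivAt (fun h : EuclideanSpace ℝ (Fin n) =>
      ∫ e in closedBall (0:EuclideanSpace ℝ (Fin n)) 1, g (e + h))
      (InnerProductSpace.toDual ℝ (EuclideanSpace ℝ (Fin n)) ((n * V) • ∫ e, g e • e ∂σ))
      (μ⁻¹ • (x - x)) := by
    rw [h0, ← hI]
    exact hder
  have hc := (HasFDerivAt.comp x hder' hA).const_smul V⁻¹
  refine hc.congr_fderiv ?_
  ext v
  simp [inner_smul_left, g]
  field_simp
end

section
/- Let n ≥ 2, μ > 0, B > 0, x ∈ ℝⁿ. Let e be a random vector uniformly distributed on the unit Euclidean sphere S₂ⁿ(1) ⊂ ℝⁿ, let ξ be a random element of a measurable space Ξ independent of e, and let f̃ : ℝⁿ × Ξ → ℝ be measurable with E_ξ[f̃(y, ξ)²] ≤ B² for every y ∈ ℝⁿ. Then the one-point gradient estimator G = (n/μ)·f̃(x + μe, ξ)·e satisfies E[‖G‖_∞²] ≤ 4·n·ln n·B²/μ². -/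
open MeasureTheory ProbabilityTheory Metric

/-- The `ℓ_∞` norm `maxᵢ |xᵢ|` on `ℝⁿ`. -/
noncomputable def linftyNorm {n : ℕ} (x : EuclideanSpace ℝ (Fin n)) : ℝ :=
  ⨆ i, |x i|

lemma map_inner_stdG {n : ℕ} (a : EuclideanSpace ℝ (Fin n)) (ha : ‖a‖ = 1) :
    (stdGaussian (EuclideanSpace ℝ (Fin n))).map (fun g => inner ℝ a g) = gaussianReal 0 1 := by
  have h := IsGaussian.map_eq_gaussianReal (μ := stdGaussian (EuclideanSpace ℝ (Fin n)))
    (innerSL ℝ a)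
  rw [integral_strongDual_stdGaussian, variance_dual_stdGaussian, innerSL_apply_norm, ha] at h
  simpa using h

lemma lintegral_exp_gauss :
    ∫⁻ y, ENNReal.ofReal (Real.exp (3/8 * y^2)) ∂(gaussianReal 0 1) = 2 := by
  rw [gaussianReal_of_var_ne_zero _ one_ne_zero,
    lintegral_withDensity_eq_lintegral_mul _ (by fun_prop) (by fun_prop)]
  have h1 : ∀ y : ℝ, (gaussianPDF 0 1 * fun y => ENNReal.ofReal (Real.exp (3/8 * y^2))) y
      = ENNReal.ofReal ((√(2 * Real.pi))⁻¹ * Real.exp (-(1/8) * y^2)) := by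
    intro y
    simp only [Pi.mul_apply, gaussianPDF, gaussianPDFReal]
    rw [← ENNReal.ofReal_mul (by positivity), mul_assoc, ← Real.exp_add]
    congr 3
    · simp
    · simp; ring
  simp_rw [h1]
  rw [← ofReal_integral_eq_lintegral_ofReal ((integrable_exp_neg_mul_sq (by norm_num)).const_mul _)
    (ae_of_all _ fun y => by positivity), integral_const_mul, integral_gaussian]
  have : (√(2 * Real.pi))⁻¹ * √(Real.pi / (1/8)) = 2 := by
    rw [show Real.pi / (1/8) = 2^2 * (2 * Real.pi) by ring, Real.sqrt_mul (x := 2^2) (by positivity),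
      Real.sqrt_sq (x := 2) (by norm_num)]
    field_simp
  rw [this]; simp

lemma integrable_coord_sq {n : ℕ} (i : Fin n) :
    Integrable (fun g : EuclideanSpace ℝ (Fin n) => (g i)^2)
      (stdGaussian (EuclideanSpace ℝ (Fin n))) ∧
    ∫ g, (g i)^2 ∂(stdGaussian (EuclideanSpace ℝ (Fin n))) = 1 := by
  have hm := map_inner_stdG (EuclideanSpace.single i (1:ℝ)) (by simp)
  simp only [EuclideanSpace.inner_single_left, map_one, one_mul] at hm
  have h2 : MemLp id 2 (gaussianReal 0 1) := memLp_id_gaussianReal 2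
  have hme : AEMeasurable (fun g : EuclideanSpace ℝ (Fin n) => g i)
    (stdGaussian (EuclideanSpace ℝ (Fin n))) := by fun_prop
  constructor
  · have : Integrable (fun y : ℝ => y^2) (gaussianReal 0 1) := h2.integrable_sq
    rw [← hm] at this
    exact this.comp_aemeasurable hme
  · have := variance_fun_id_gaussianReal (μ := 0) (v := 1)
    rw [variance_of_integral_eq_zero (by fun_prop) (by simp)] at this
    rw [← hm, integral_map hme (by fun_prop)] at this
    simpa using this

lemma integrable_norm_sq {n : ℕ} :
    Integrable (fun g : EuclideanSpace ℝ (Fin n) => ‖g‖^2)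
      (stdGaussian (EuclideanSpace ℝ (Fin n))) ∧
    ∫ g, ‖g‖^2 ∂(stdGaussian (EuclideanSpace ℝ (Fin n))) = n := by
  simp_rw [EuclideanSpace.real_norm_sq_eq]
  constructor
  · exact integrable_finsetSum _ fun i _ => (integrable_coord_sq i).1
  · rw [integral_finsetSum _ fun i _ => (integrable_coord_sq i).1]
    simp [(integrable_coord_sq _).2]

lemma jensen_g {n : ℕ} (c : ℝ) :
    ENNReal.ofReal (Real.exp (c * n)) ≤
      ∫⁻ g : EuclideanSpace ℝ (Fin n), ENNReal.ofReal (Real.exp (c * ‖g‖^2))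
        ∂(stdGaussian (EuclideanSpace ℝ (Fin n))) := by
  set γ := stdGaussian (EuclideanSpace ℝ (Fin n))
  obtain ⟨hi, hv⟩ := integrable_norm_sq (n := n)
  by_cases hint : Integrable (fun g : EuclideanSpace ℝ (Fin n) => Real.exp (c * ‖g‖^2)) γ
  · rw [← ofReal_integral_eq_lintegral_ofReal hint (ae_of_all _ fun y => by positivity)]
    apply ENNReal.ofReal_le_ofReal
    have hE : ∫ g : EuclideanSpace ℝ (Fin n),
        Real.exp (c * n) * (1 + c * (‖g‖^2 - n)) ∂γ = Real.exp (c * n) := by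
      have hc : Integrable (fun g : EuclideanSpace ℝ (Fin n) => c * (‖g‖^2 - n)) γ :=
        (hi.sub (integrable_const _)).const_mul _
      rw [integral_const_mul, integral_add (integrable_const _) hc, integral_const_mul,
        integral_sub hi (integrable_const _), hv]
      simp
    rw [← hE]
    refine integral_mono ?_ hint ?_
    · exact ((integrable_const _).add ((hi.sub (integrable_const _)).const_mul _)).const_mul _
    · intro g
      have h := Real.add_one_le_exp (c * (‖g‖^2 - n))
      calc Real.exp (c * n) * (1 + c * (‖g‖^2 - n))
          ≤ Real.exp (c * n) * Real.exp (c * (‖g‖^2 - n)) := by gcongr; linarith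
        _ = Real.exp (c * ‖g‖^2) := by rw [← Real.exp_add]; congr 1; ring
  · have : ∫⁻ g : EuclideanSpace ℝ (Fin n), ENNReal.ofReal (Real.exp (c * ‖g‖^2)) ∂γ = ⊤ := by
      by_contra h
      apply hint
      replace h := lt_top_iff_ne_top.2 h
      refine ⟨by fun_prop, ?_⟩
      rw [hasFiniteIntegral_iff_ofReal (ae_of_all _ fun y => by positivity)]
      exact h
    rw [this]; exact le_top

lemma uniform_exp {n : ℕ} (σ : Measure (EuclideanSpace ℝ (Fin n))) (hσ : IsUniformOnSphere σ)
    (i : Fin n) :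
    ∫⁻ e, ENNReal.ofReal (Real.exp (3/8 * n * (e i)^2)) ∂σ ≤ 2 := by
  obtain ⟨hp, hs, hT⟩ := hσ
  set γ := stdGaussian (EuclideanSpace ℝ (Fin n)) with hγ
  have hrot : ∀ g : EuclideanSpace ℝ (Fin n),
      ∫⁻ e, ENNReal.ofReal (Real.exp (3/8 * (inner ℝ e g)^2)) ∂σ
      = ∫⁻ e, ENNReal.ofReal (Real.exp (3/8 * (e i)^2 * ‖g‖^2)) ∂σ := by
    intro g
    set v : EuclideanSpace ℝ (Fin n) := EuclideanSpace.single i ‖g‖ with hv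
    have hvn : ‖v‖ = ‖g‖ := by simp [hv]
    set T := Submodule.reflection (ℝ ∙ (v - g))ᗮ with hTdef
    have hTv : T v = g := Submodule.reflection_sub hvn
    have hTg : T g = v := by rw [← hTv]; exact Submodule.reflection_reflection _ _
    conv_lhs => rw [← hT T]
    rw [lintegral_map (by fun_prop) (by fun_prop)]
    refine lintegral_congr fun e => ?_
    have : inner ℝ (T e) g = inner ℝ e v := by
      rw [← hTv, T.inner_map_map]
    rw [this, hv, EuclideanSpace.inner_single_right]
    congr 2
    simp; ring
  calc ∫⁻ e, ENNReal.ofReal (Real.exp (3/8 * n * (e i)^2)) ∂σ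
      ≤ ∫⁻ e, ∫⁻ g, ENNReal.ofReal (Real.exp (3/8 * (e i)^2 * ‖g‖^2)) ∂γ ∂σ := by
        refine lintegral_mono fun e => ?_
        rw [show 3/8 * n * (e i)^2 = 3/8 * (e i)^2 * n by ring]
        exact jensen_g _
    _ = ∫⁻ g, ∫⁻ e, ENNReal.ofReal (Real.exp (3/8 * (e i)^2 * ‖g‖^2)) ∂σ ∂γ := by
        rw [lintegral_lintegral_swap]
        simp only [Function.uncurry_def]
        fun_prop
    _ = ∫⁻ g, ∫⁻ e, ENNReal.ofReal (Real.exp (3/8 * (inner ℝ e g)^2)) ∂σ ∂γ := by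
        simp_rw [hrot]
    _ = ∫⁻ e, ∫⁻ g, ENNReal.ofReal (Real.exp (3/8 * (inner ℝ e g)^2)) ∂γ ∂σ := by
        rw [lintegral_lintegral_swap]
        simp only [Function.uncurry_def]
        fun_prop
    _ = ∫⁻ e, 2 ∂σ := by
        refine lintegral_congr_ae ?_
        have : ∀ᵐ e ∂σ, e ∈ Metric.sphere (0 : EuclideanSpace ℝ (Fin n)) 1 := hs
        filter_upwards [this] with e he
        refine Eq.trans ?_ lintegral_exp_gauss
        rw [← map_inner_stdG e (by simpa using he),
          lintegral_map (by fun_prop) (by fun_prop)]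
    _ = 2 := by simp

lemma linftyNorm_nonneg {n : ℕ} (e : EuclideanSpace ℝ (Fin n)) : 0 ≤ linftyNorm e :=
  Real.iSup_nonneg fun _ => abs_nonneg _

lemma exists_linftyNorm {n : ℕ} (hn : 2 ≤ n) (e : EuclideanSpace ℝ (Fin n)) :
    ∃ i, linftyNorm e = |e i| := by
  have : Nonempty (Fin n) := ⟨⟨0, by omega⟩⟩
  obtain ⟨i, hi⟩ := exists_eq_ciSup_of_finite (f := fun i => |e i|)
  exact ⟨i, hi.symm⟩

lemma linftyNorm_smul {n : ℕ} (c : ℝ) (e : EuclideanSpace ℝ (Fin n)) :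
    linftyNorm (c • e) = |c| * linftyNorm e := by
  simp only [linftyNorm, PiLp.smul_apply, smul_eq_mul, abs_mul]
  rw [Real.mul_iSup_of_nonneg (abs_nonneg c)]

lemma measurable_linftyNorm {n : ℕ} :
    Measurable (linftyNorm : EuclideanSpace ℝ (Fin n) → ℝ) := by
  unfold linftyNorm
  exact Measurable.iSup fun i => by fun_prop

lemma linftyNorm_sq_le {n : ℕ} (hn : 2 ≤ n) (e : EuclideanSpace ℝ (Fin n)) :
    linftyNorm e ^ 2 ≤ ‖e‖^2 := by
  obtain ⟨i, hi⟩ := exists_linftyNorm hn e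
  rw [hi, sq_abs, EuclideanSpace.real_norm_sq_eq]
  exact Finset.single_le_sum (f := fun i => (e i)^2) (fun _ _ => sq_nonneg _) (Finset.mem_univ i)

lemma sphere_facts {n : ℕ} (hn : 2 ≤ n) (σ : Measure (EuclideanSpace ℝ (Fin n)))
    (hσ : IsUniformOnSphere σ) :
    (∀ᵐ e ∂σ, linftyNorm e ^ 2 ≤ 1) ∧ Integrable (fun e => linftyNorm e ^ 2) σ := by
  obtain ⟨hp, hs, -⟩ := hσ
  have h0 : ∀ᵐ e ∂σ, e ∈ Metric.sphere (0 : EuclideanSpace ℝ (Fin n)) 1 := hs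
  have h1 : ∀ᵐ e ∂σ, linftyNorm e ^ 2 ≤ 1 := by
    filter_upwards [h0] with e he
    have h := linftyNorm_sq_le hn e
    have h' : ‖e‖ = 1 := by simpa using he
    rw [h'] at h; simpa using h
  refine ⟨h1, ?_⟩
  refine Integrable.of_bound (measurable_linftyNorm.pow_const 2).aestronglyMeasurable 1 ?_
  filter_upwards [h1] with e he
  rw [Real.norm_of_nonneg (sq_nonneg _)]; exact he

lemma sphere_max {n : ℕ} (hn : 2 ≤ n) (σ : Measure (EuclideanSpace ℝ (Fin n)))
    (hσ : IsUniformOnSphere σ) :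
    n * ∫ e, linftyNorm e ^ 2 ∂σ ≤ 4 * Real.log n := by
  obtain ⟨hb, hI⟩ := sphere_facts hn σ hσ
  have := hσ.1
  have hn0 : (0:ℝ) < n := by positivity
  by_cases h4 : n < 4
  · have h1 : ∫ e, linftyNorm e ^ 2 ∂σ ≤ 1 := by
      have := integral_mono_ae hI (integrable_const (1:ℝ)) hb
      simpa using this
    have h2 : (n:ℝ) ≤ 4 * Real.log n := by
      interval_cases n
      · have := Real.log_two_gt_d9
        push_cast; linarith
      · have : (3/4:ℝ) ≤ Real.log 3 := by
          rw [Real.le_log_iff_exp_le (by norm_num)]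
          have h := Real.exp_one_lt_d9
          have : Real.exp (3/4) ≤ Real.exp 1 := Real.exp_le_exp.2 (by norm_num)
          linarith
        push_cast; linarith
    nlinarith
  · push Not at h4
    have hex : ∀ i : Fin n, Integrable (fun e => Real.exp (3/8 * n * (e i)^2)) σ ∧
        ∫ e, Real.exp (3/8 * n * (e i)^2) ∂σ ≤ 2 := by
      intro i
      have h := uniform_exp σ hσ i
      have hint : Integrable (fun e : EuclideanSpace ℝ (Fin n) =>
          Real.exp (3/8 * n * (e i)^2)) σ := by
        refine ⟨by fun_prop, ?_⟩
        rw [hasFiniteIntegral_iff_ofReal (ae_of_all _ fun y => by positivity)]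
        exact h.trans_lt (by simp)
      refine ⟨hint, ?_⟩
      rw [← ofReal_integral_eq_lintegral_ofReal hint (ae_of_all _ fun y => by positivity)] at h
      rw [← ENNReal.ofReal_le_ofReal_iff (by norm_num)]
      simpa using h
    have hsumI : Integrable (fun e : EuclideanSpace ℝ (Fin n) =>
        ∑ i, Real.exp (3/8 * n * (e i)^2)) σ := integrable_finsetSum _ fun i _ => (hex i).1
    have hsum : ∫ e, ∑ i, Real.exp (3/8 * n * (e i)^2) ∂σ ≤ 2 * n := by
      rw [integral_finsetSum _ fun i _ => (hex i).1]
      calc _ ≤ ∑ i : Fin n, (2:ℝ) := Finset.sum_le_sum fun i _ => (hex i).2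
        _ = 2 * n := by simp; ring
    have hpt : ∀ e : EuclideanSpace ℝ (Fin n), 3/8 * n * linftyNorm e ^ 2 ≤
        (∑ i, Real.exp (3/8 * n * (e i)^2)) / (2 * n) + (Real.log (2 * n) - 1) := by
      intro e
      obtain ⟨i, hi⟩ := exists_linftyNorm hn e
      rw [hi, sq_abs]
      have h1 : Real.exp (3/8 * n * (e i)^2) ≤ ∑ i, Real.exp (3/8 * n * (e i)^2) :=
        Finset.single_le_sum (f := fun i => Real.exp (3/8 * n * (e i)^2))
          (fun _ _ => by positivity) (Finset.mem_univ i)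
      have h2 := Real.add_one_le_exp (3/8 * n * (e i)^2 - Real.log (2 * n))
      rw [Real.exp_sub, Real.exp_log (by positivity)] at h2
      have h3 : Real.exp (3/8 * n * (e i)^2) / (2 * n) ≤
        (∑ i, Real.exp (3/8 * n * (e i)^2)) / (2 * n) := by gcongr
      linarith
    have hm := integral_mono (hI.const_mul (3/8 * n))
      ((hsumI.div_const (2 * n)).add (integrable_const (Real.log (2 * n) - 1))) hpt
    simp only [Pi.add_apply] at hm
    rw [integral_const_mul, integral_add (hsumI.div_const _) (integrable_const _),
      integral_div] at hm
    simp only [integral_const, probReal_univ, one_smul] at hm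
    have h5 : (∫ e, ∑ i, Real.exp (3/8 * n * (e i)^2) ∂σ) / (2 * n) ≤ 1 := by
      rw [div_le_one (by positivity)]; exact hsum
    have h6 : Real.log (2 * n) = Real.log 2 + Real.log n := Real.log_mul (by norm_num) hn0.ne'
    have h7 : 2 * Real.log 2 ≤ Real.log n := by
      have : Real.log ((2:ℝ)^2) ≤ Real.log n := by
        apply Real.log_le_log (by norm_num)
        have : (4:ℝ) ≤ n := by exact_mod_cast h4
        linarith
      simpa [Real.log_pow] using this
    linarith

/-- Second-moment bound (in the `ℓ_∞` norm) for the one-point gradient-free oracle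
`G = (n/μ) f̃(x + μe, ξ) e`: if `E_ξ[f̃(y,ξ)²] ≤ B²` for all `y`, `e` is uniform on the unit
Euclidean sphere and independent of `ξ`, then `E[‖G‖_∞²] ≤ 4 n ln n B²/μ²`. -/
theorem one_point_oracle_second_moment_linfty {n : ℕ} (hn : 2 ≤ n)
    (μ B : ℝ) (hμ : 0 < μ) (hB : 0 < B) (x : EuclideanSpace ℝ (Fin n))
    {Ω Ξ : Type} [MeasurableSpace Ω] [MeasurableSpace Ξ]
    (P : Measure Ω) [IsProbabilityMeasure P]
    (e : Ω → EuclideanSpace ℝ (Fin n)) (ξ : Ω → Ξ)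
    (he : Measurable e) (hξ : Measurable ξ)
    (hlaw : IsUniformOnSphere (P.map e)) (hindep : IndepFun e ξ P)
    (ft : EuclideanSpace ℝ (Fin n) → Ξ → ℝ) (hft : Measurable (Function.uncurry ft))
    (hB2 : ∀ y : EuclideanSpace ℝ (Fin n), ∫ ω, ft y (ξ ω) ^ 2 ∂P ≤ B ^ 2) :
    ∫ ω, linftyNorm ((n / μ * ft (x + μ • e ω) (ξ ω)) • e ω) ^ 2 ∂P ≤
      4 * n * Real.log n * B ^ 2 / μ ^ 2 := by
  have hlog : 0 ≤ Real.log n := Real.log_natCast_nonneg n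
  by_cases hint : Integrable
      (fun ω => linftyNorm ((n / μ * ft (x + μ • e ω) (ξ ω)) • e ω) ^ 2) P
  swap
  · rw [integral_undef hint]; positivity
  have : IsProbabilityMeasure (P.map e) := hlaw.1
  have : IsProbabilityMeasure (P.map ξ) := Measure.isProbabilityMeasure_map hξ.aemeasurable
  set F : EuclideanSpace ℝ (Fin n) × Ξ → ℝ := fun p =>
    ((n / μ) ^ 2 * linftyNorm p.1 ^ 2) * ft (x + μ • p.1) p.2 ^ 2 with hF
  have hFm : Measurable F := by
    have h1 : Measurable fun p : EuclideanSpace ℝ (Fin n) × Ξ => ft (x + μ • p.1) p.2 :=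
      hft.comp (f := fun p : EuclideanSpace ℝ (Fin n) × Ξ => (x + μ • p.1, p.2)) (by fun_prop)
    have h2 : Measurable fun p : EuclideanSpace ℝ (Fin n) × Ξ => linftyNorm p.1 :=
      measurable_linftyNorm.comp measurable_fst
    exact ((h2.pow_const 2).const_mul _).mul (h1.pow_const 2)
  have heq : (fun ω => linftyNorm ((n / μ * ft (x + μ • e ω) (ξ ω)) • e ω) ^ 2)
      = fun ω => F (e ω, ξ ω) := by
    funext ω
    simp only [hF]
    rw [linftyNorm_smul, mul_pow, sq_abs]; ring
  have hmap := hindep.map_prod_eq_prod_map_map he.aemeasurable hξ.aemeasurable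
  have hpm : AEMeasurable (fun ω => (e ω, ξ ω)) P := (he.prodMk hξ).aemeasurable
  have hFint : Integrable F ((P.map e).prod (P.map ξ)) := by
    rw [← hmap, integrable_map_measure hFm.aestronglyMeasurable hpm]
    rw [heq] at hint; exact hint
  obtain ⟨-, hI⟩ := sphere_facts hn _ hlaw
  have hmax := sphere_max hn _ hlaw
  rw [heq, ← integral_map hpm hFm.aestronglyMeasurable, hmap, integral_prod _ hFint]
  calc ∫ y, ∫ z, F (y, z) ∂(P.map ξ) ∂(P.map e)
      ≤ ∫ y, ((n / μ) ^ 2 * B ^ 2) * linftyNorm y ^ 2 ∂(P.map e) := by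
        refine integral_mono hFint.integral_prod_left (hI.const_mul _) fun y => ?_
        simp only [hF]
        rw [integral_const_mul]
        have hfy : Measurable fun z => ft (x + μ • y) z ^ 2 :=
          (hft.of_uncurry_left).pow_const 2
        rw [integral_map hξ.aemeasurable hfy.aestronglyMeasurable]
        calc _ ≤ ((n / μ) ^ 2 * linftyNorm y ^ 2) * B ^ 2 := by gcongr; exact hB2 _
          _ = _ := by ring
    _ = (n * B ^ 2 / μ ^ 2) * (n * ∫ y, linftyNorm y ^ 2 ∂(P.map e)) := by
        rw [integral_const_mul]; ring
    _ ≤ (n * B ^ 2 / μ ^ 2) * (4 * Real.log n) := by gcongr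
    _ = 4 * n * Real.log n * B ^ 2 / μ ^ 2 := by ring
end
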